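/- There exists a distinct covering system with least modulus 5 whose moduli have least common multiple equal to 2^4·3^3·5 = 2160 and which contains no congruence with modulus 180. -/

import Mathlib

/-- Pairs `(n, a)` standing for the congruences `x ≡ a [ZMOD n]` of a distinct covering system. -/
def coveringPairs : List (ℕ × ℕ) :=
  [(5, 3), (6, 4), (8, 5), (9, 0), (10, 0), (12, 7), (15, 11),
   (16, 1), (18, 6), (20, 12), (24, 23), (27, 12), (30, 14), (36, 15),
   (40, 19), (45, 32), (48, 25), (54, 30), (60, 2), (72, 3), (80, 25),
   (90, 17), (108, 75), (120, 35), (135, 129), (144, 105), (216, 111), (240, 89),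
   (270, 156), (360, 227), (432, 57), (540, 102), (720, 137), (1080, 777), (2160, 1641)]

/-- The residue attached to the modulus `n` in `coveringPairs` (and `0` for other `n`). -/
def coveringResidue (n : ℕ) : ℕ := (coveringPairs.lookup n).getD 0

theorem exists_coveringPairs_mod_eq :
    ∀ k < 2160, ∃ p ∈ coveringPairs, k % p.1 = p.2 := by
  have key : ∀ a < 45, ∀ b < 48, ∃ p ∈ coveringPairs, (48 * a + b) % p.1 = p.2 := by
    decide +kernel
  intro k hk
  simpa only [Nat.div_add_mod] using key (k / 48) (by lia) (k % 48) (by lia)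

theorem coveringPairs_spec :
    ∀ p ∈ coveringPairs, 5 ≤ p.1 ∧ p.1 ∣ 2160 ∧ coveringResidue p.1 = p.2 := by
  decide +kernel

/-- There exists a distinct covering system with least modulus 5, lcm of moduli 2^4 * 3^3 * 5 = 2160, containing no congruence with modulus 180. -/
theorem exists_covering_m5_L2160_no180 :
    ∃ (S : Finset ℕ) (r : ℕ → ℤ),
      (∀ n ∈ S, 1 < n) ∧
      (∀ x : ℤ, ∃ n ∈ S, x ≡ r n [ZMOD (n : ℤ)]) ∧
      (5 ∈ S ∧ ∀ n ∈ S, 5 ≤ n) ∧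
      S.lcm id = 2 ^ 4 * 3 ^ 3 * 5 ∧
      180 ∉ S := by
  refine ⟨(coveringPairs.map Prod.fst).toFinset, fun n => coveringResidue n, ?_, ?_, ⟨?_, ?_⟩, ?_, ?_⟩
  · intro n hn
    obtain ⟨p, hp, rfl⟩ := List.mem_map.1 (List.mem_toFinset.1 hn)
    have := (coveringPairs_spec p hp).1
    lia
  · intro x
    obtain ⟨p, hp, hk⟩ := exists_coveringPairs_mod_eq (x % 2160).toNat (by lia)
    obtain ⟨-, hdvd, hres⟩ := coveringPairs_spec p hp
    refine ⟨p.1, List.mem_toFinset.2 (List.mem_map_of_mem hp), ?_⟩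
    have hcast : (((x % 2160).toNat : ℕ) : ℤ) = x % 2160 := Int.toNat_of_nonneg (by lia)
    have hdvd' : (p.1 : ℤ) ∣ 2160 := by exact_mod_cast hdvd
    beta_reduce
    rw [hres, ← hk, Int.natCast_mod, hcast]
    exact ((Int.mod_modEq _ _).trans ((Int.mod_modEq x 2160).of_dvd hdvd')).symm
  · decide +kernel
  · intro n hn
    obtain ⟨p, hp, rfl⟩ := List.mem_map.1 (List.mem_toFinset.1 hn)
    exact (coveringPairs_spec p hp).1
  · apply Nat.dvd_antisymm
    · refine Finset.lcm_dvd fun n hn => ?_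
      obtain ⟨p, hp, rfl⟩ := List.mem_map.1 (List.mem_toFinset.1 hn)
      exact (coveringPairs_spec p hp).2.1
    · exact Finset.dvd_lcm (f := id) (b := 2160) (by decide +kernel)
  · decide +kernel
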